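/- arXiv:1806.09660 — 2 statements merged into one kernel-verified Lean document; each statement's English description precedes it below -/
import Mathlib

section
/- Let q be a prime power, n ≥ 1, and let L ∈ F_q[x_1,…,x_n] be a nonzero homogeneous polynomial of degree 1. Let α ∈ F_q and let g ∈ F_q[x_1,…,x_n] be a polynomial of total degree at most d that is not divisible by the polynomial L − α. Then q · #{u ∈ F_q^n : L(u) = α and g(u) = 0} ≤ d · q^{n−1}; equivalently, a uniformly random point u of the affine hyperplane V_α = {u ∈ F_q^n : L(u) = α} satisfies g(u) = 0 with probability at most d/q. -/
open scoped Classical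

theorem aux_linear {F : Type*} [Field F] {n : ℕ}
    (L : MvPolynomial (Fin n) F) (hL : L.IsHomogeneous 1) :
    ∃ c : Fin n → F, L = ∑ i, MvPolynomial.C (c i) * MvPolynomial.X i := by
  have h1 := hL.sum_X_mul_pderiv
  have h2 : ∀ i, ∃ c : F, MvPolynomial.pderiv i L = MvPolynomial.C c := fun i => by
    have h3 : (MvPolynomial.pderiv i L).IsHomogeneous 0 := hL.pderiv
    have h4 : (MvPolynomial.pderiv i L).totalDegree = 0 := Nat.le_zero.mp h3.totalDegree_le
    exact ⟨_, MvPolynomial.totalDegree_eq_zero_iff_eq_C.mp h4⟩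
  choose c hc using h2
  refine ⟨c, ?_⟩
  rw [one_smul] at h1
  rw [← h1]
  refine Finset.sum_congr rfl fun i _ => ?_
  rw [hc i, mul_comm]

theorem aux_deg {F : Type*} [Field F] {n m : ℕ}
    (f : Fin n → MvPolynomial (Fin m) F) (hf : ∀ i, (f i).totalDegree ≤ 1)
    (g : MvPolynomial (Fin n) F) :
    (MvPolynomial.aeval f g).totalDegree ≤ g.totalDegree := by
  rw [MvPolynomial.aeval_def, MvPolynomial.eval₂_eq]
  refine MvPolynomial.totalDegree_finsetSum_le fun s hs => ?_
  refine (MvPolynomial.totalDegree_mul _ _).trans ?_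
  rw [MvPolynomial.algebraMap_eq, MvPolynomial.totalDegree_C, zero_add]
  refine (MvPolynomial.totalDegree_finsetProd _ _).trans ?_
  refine le_trans ?_ (MvPolynomial.le_totalDegree hs)
  refine Finset.sum_le_sum fun i _ => ?_
  refine (MvPolynomial.totalDegree_pow _ _).trans ?_
  exact (Nat.mul_le_mul_left _ (hf i)).trans (by simp)

/-- Let `q` be a prime power (here: `F` a finite field with `q = |F|`
elements), `n ≥ 1`, and let `L ∈ F[x_1,…,x_n]` be a nonzero homogeneous polynomial of
degree 1.  Let `α ∈ F` and let `g` be a polynomial of total degree at most `d` that is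
not divisible by `L − α`.  Then
`q · #{u ∈ F^n : L(u) = α ∧ g(u) = 0} ≤ d · q^(n−1)`;
i.e. a uniformly random point of the affine hyperplane `V_α = {u : L(u) = α}` is a zero
of `g` with probability at most `d/q`. -/
theorem stmt_0 {F : Type*} [Field F] [Fintype F] {n d : ℕ} (hn : 1 ≤ n)
    (L : MvPolynomial (Fin n) F) (hL : L.IsHomogeneous 1) (hL0 : L ≠ 0)
    (α : F) (g : MvPolynomial (Fin n) F) (hg : g.totalDegree ≤ d)
    (hdvd : ¬ (L - MvPolynomial.C α ∣ g)) :
    Fintype.card F *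
      (Finset.univ.filter (fun u : Fin n → F =>
        MvPolynomial.eval u L = α ∧ MvPolynomial.eval u g = 0)).card ≤
      d * Fintype.card F ^ (n - 1) := by
  obtain ⟨c, rfl⟩ := aux_linear L hL
  obtain ⟨k, hk⟩ : ∃ k, c k ≠ 0 := by
    by_contra! h
    exact hL0 (by simp [h])
  obtain ⟨m, rfl⟩ : ∃ m, n = m + 1 := ⟨n - 1, by omega⟩
  set r : MvPolynomial (Fin m) F := MvPolynomial.C (c k)⁻¹ *
    (MvPolynomial.C α - ∑ j, MvPolynomial.C (c (k.succAbove j)) * MvPolynomial.X j) with hr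
  set f : Fin (m + 1) → MvPolynomial (Fin m) F :=
    Fin.insertNth (α := fun _ => MvPolynomial (Fin m) F) k r MvPolynomial.X with hf
  have hfk : f k = r := by simp [hf]
  have hfj : ∀ j, f (k.succAbove j) = MvPolynomial.X j := fun j => by simp [hf]
  have hdeg : ∀ i, (f i).totalDegree ≤ 1 := by
    rw [Fin.forall_iff_succAbove k]
    refine ⟨?_, fun j => by rw [hfj, MvPolynomial.totalDegree_X]⟩
    rw [hfk, hr]
    refine (MvPolynomial.totalDegree_mul _ _).trans ?_
    rw [MvPolynomial.totalDegree_C, zero_add]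
    refine (MvPolynomial.totalDegree_sub _ _).trans ?_
    rw [MvPolynomial.totalDegree_C]
    refine max_le (Nat.zero_le _) (MvPolynomial.totalDegree_finsetSum_le fun j _ => ?_)
    refine (MvPolynomial.totalDegree_mul _ _).trans ?_
    rw [MvPolynomial.totalDegree_C, MvPolynomial.totalDegree_X]
  have hne : MvPolynomial.aeval f g ≠ 0 := by
    intro h0
    apply hdvd
    rw [← Ideal.mem_span_singleton, ← Ideal.Quotient.eq_zero_iff_mem]
    set I := Ideal.span {(∑ i, MvPolynomial.C (c i) * MvPolynomial.X i - MvPolynomial.C α :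
      MvPolynomial (Fin (m + 1)) F)} with hI
    have key : ((Ideal.Quotient.mkₐ F I).comp (MvPolynomial.rename k.succAbove)).comp
        (MvPolynomial.aeval f) = Ideal.Quotient.mkₐ F I := by
      apply MvPolynomial.algHom_ext
      rw [Fin.forall_iff_succAbove k]
      constructor
      · simp only [AlgHom.comp_apply, MvPolynomial.aeval_X, hfk]
        rw [Ideal.Quotient.mkₐ_eq_mk, Ideal.Quotient.eq, hI, Ideal.mem_span_singleton]
        refine ⟨- MvPolynomial.C (c k)⁻¹, ?_⟩
        have hone : (MvPolynomial.C (c k)⁻¹ * MvPolynomial.C (c k) :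
            MvPolynomial (Fin (m + 1)) F) = 1 := by
          rw [← MvPolynomial.C_mul, inv_mul_cancel₀ hk, MvPolynomial.C_1]
        rw [hr, Fin.sum_univ_succAbove _ k]
        simp only [map_mul, map_sub, map_sum, MvPolynomial.rename_C, MvPolynomial.rename_X]
        linear_combination (MvPolynomial.X k) * hone
      · intro j
        simp only [AlgHom.comp_apply, MvPolynomial.aeval_X, hfj, MvPolynomial.rename_X]
    have := DFunLike.congr_fun key g
    simp only [AlgHom.comp_apply, h0, map_zero] at this
    exact this.symm
  have hrec : ∀ u : Fin (m + 1) → F,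
      MvPolynomial.eval u (∑ i, MvPolynomial.C (c i) * MvPolynomial.X i) = α →
      (fun i => MvPolynomial.eval (fun j => u (k.succAbove j)) (f i)) = u := by
    intro u hu
    funext i
    revert i
    rw [Fin.forall_iff_succAbove k]
    refine ⟨?_, fun j => by rw [hfj, MvPolynomial.eval_X]⟩
    rw [Fin.sum_univ_succAbove _ k] at hu
    simp only [map_add, map_mul, map_sum, MvPolynomial.eval_C, MvPolynomial.eval_X] at hu
    rw [hfk, hr]
    simp only [map_mul, map_sub, map_sum, MvPolynomial.eval_C, MvPolynomial.eval_X]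
    rw [← hu]
    field_simp
    ring
  have hsz := MvPolynomial.schwartz_zippel_totalDegree hne (Finset.univ : Finset F)
  rw [Fintype.piFinset_univ, Finset.card_univ] at hsz
  have hq : (0 : ℚ≥0) < Fintype.card F := by exact_mod_cast Fintype.card_pos
  rw [div_le_div_iff₀ (by positivity) hq] at hsz
  have hcard : (Finset.univ.filter (fun u : Fin (m + 1) → F =>
        MvPolynomial.eval u (∑ i, MvPolynomial.C (c i) * MvPolynomial.X i) = α ∧
          MvPolynomial.eval u g = 0)).card ≤
      (Finset.univ.filter (fun v : Fin m → F =>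
        MvPolynomial.eval v (MvPolynomial.aeval f g) = 0)).card := by
    refine Finset.card_le_card_of_injOn (fun u j => u (k.succAbove j)) ?_ ?_
    · intro u hu
      simp only [Finset.coe_filter, Finset.mem_univ, true_and, Set.mem_ofPred_eq] at hu ⊢
      have h1 : MvPolynomial.eval (fun j => u (k.succAbove j)) (MvPolynomial.aeval f g) =
          MvPolynomial.eval
            (fun i => MvPolynomial.eval (fun j => u (k.succAbove j)) (f i)) g := by
        rw [MvPolynomial.aeval_def, MvPolynomial.eval₂_eq,
          MvPolynomial.eval_eq (fun i => MvPolynomial.eval (fun j => u (k.succAbove j)) (f i)) g]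
        simp only [map_sum, map_mul, map_prod, map_pow, MvPolynomial.algebraMap_eq,
          MvPolynomial.eval_C]
      rw [h1, hrec u hu.1, hu.2]
    · intro u hu v hv huv
      simp only [Finset.coe_filter, Finset.mem_univ, true_and, Set.mem_ofPred_eq] at hu hv
      have h2 := hrec u hu.1
      have huv2 : (fun j => u (k.succAbove j)) = fun j => v (k.succAbove j) := huv
      rw [huv2, hrec v hv.1] at h2
      exact h2.symm
  have hsz2 : (Finset.univ.filter (fun v : Fin m → F =>
        MvPolynomial.eval v (MvPolynomial.aeval f g) = 0)).card * Fintype.card F ≤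
      (MvPolynomial.aeval f g).totalDegree * Fintype.card F ^ m := by
    exact_mod_cast hsz
  rw [Nat.add_sub_cancel]
  calc _ ≤ _ := Nat.mul_le_mul_left _ hcard
    _ = _ := Nat.mul_comm _ _
    _ ≤ _ := hsz2
    _ ≤ _ := Nat.mul_le_mul_right _ ((aux_deg f hdeg g).trans hg)
end

section
/- Let q be a prime power, n ≥ 1, and A ⊆ F_q with |A| < q. Let ℓ, ℓ' : F_q^n → F_q be nonzero linear maps, and let p be a probability distribution on F_q^n that is simultaneously an (A,ℓ)-distribution and an (A,ℓ')-distribution. Then there exists a nonzero constant c ∈ F_q such that ℓ' = c·ℓ. -/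
/-- Let `q` be a prime power (here `F` a finite field), `n ≥ 1`, and
`A ⊆ F_q` with `|A| < q`.  Let `ℓ, ℓ' : F_q^n → F_q` be nonzero linear maps, and let
`p` be a probability distribution on `F_q^n` that is simultaneously an
`(A,ℓ)`-distribution and an `(A,ℓ')`-distribution.  Then there is a nonzero constant
`c ∈ F_q` with `ℓ' = c·ℓ`. -/
theorem stmt_6 {F : Type*} [Field F] [Fintype F] {n : ℕ} (hn : 1 ≤ n)
    (A : Finset F) (hA : A.card < Fintype.card F)
    (ℓ ℓ' : (Fin n → F) →ₗ[F] F) (hℓ : ℓ ≠ 0) (hℓ' : ℓ' ≠ 0)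
    (p : (Fin n → F) → ℝ) (hp0 : ∀ u, 0 ≤ p u) (hp1 : ∑ u, p u = 1)
    (hsym : ∀ u v, ℓ u = ℓ v → p u = p v)
    (hsupp : ∀ u, ℓ u ∉ A → p u = 0)
    (hsym' : ∀ u v, ℓ' u = ℓ' v → p u = p v)
    (hsupp' : ∀ u, ℓ' u ∉ A → p u = 0) :
    ∃ c : F, c ≠ 0 ∧ ℓ' = c • ℓ := by
  have hker : ∀ w, ℓ w = 0 → ℓ' w = 0 := by
    intro w hw
    by_contra hw'
    obtain ⟨u, hu⟩ : ∃ u, p u ≠ 0 := by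
      by_contra h
      push Not at h
      simp [h] at hp1
    obtain ⟨b, hb⟩ : ∃ b, b ∉ A := by
      by_contra h
      push Not at h
      have : A = Finset.univ := Finset.eq_univ_iff_forall.mpr h
      rw [this, Finset.card_univ] at hA
      exact lt_irrefl _ hA
    apply hu
    rw [hsym u (u + ((b - ℓ' u) / ℓ' w) • w) (by simp [hw])]
    apply hsupp'
    have : ℓ' (u + ((b - ℓ' u) / ℓ' w) • w) = b := by
      simp only [map_add, map_smul, smul_eq_mul]
      field_simp
      ring
    rwa [this]
  obtain ⟨x, hx⟩ : ∃ x, ℓ x ≠ 0 := by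
    by_contra h
    push Not at h
    exact hℓ (LinearMap.ext h)
  have key : ℓ' = (ℓ' x / ℓ x) • ℓ := by
    apply LinearMap.ext
    intro y
    have h := hker (y - (ℓ y / ℓ x) • x) (by
      simp only [map_sub, map_smul, smul_eq_mul]
      field_simp
      ring)
    simp only [map_sub, map_smul, smul_eq_mul] at h
    simp only [LinearMap.smul_apply, smul_eq_mul]
    rw [sub_eq_zero.mp h]
    ring
  refine ⟨ℓ' x / ℓ x, ?_, key⟩
  intro h
  rw [h, zero_smul] at key
  exact hℓ' key
end
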